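/- Let H_0 be the free Dirac operator on ℝ³, let P_± be its spectral projections onto the positive and negative spectral subspaces, and let P_u and P_l be the orthogonal projections onto the subspaces of upper- and lower-component spinors. Then ‖P_u − P_+‖ = ‖P_l − P_−‖ = 1/√2. -/

import Mathlib

noncomputable section

open Complex Filter Topology MeasureTheory

namespace Paper

variable {X : Type*} [NormedAddCommGroup X] [NormedSpace ℂ X]

/-- `R` is a (two-sided) bounded resolvent of the unbounded operator `T` at the point `z`. -/
def IsResolventAt (T : X →ₗ.[ℂ] X) (z : ℂ) (R : X →L[ℂ] X) : Prop :=
  (∀ u : T.domain, R (T u - z • (u : X)) = u) ∧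
  (∀ y : X, ∃ hy : R y ∈ T.domain, T ⟨R y, hy⟩ - z • R y = y)

/-- The resolvent set of an unbounded operator. -/
def resolventSet (T : X →ₗ.[ℂ] X) : Set ℂ := {z | ∃ R, IsResolventAt T z R}

/-- The spectrum of an unbounded operator. -/
def spec (T : X →ₗ.[ℂ] X) : Set ℂ := (resolventSet T)ᶜ

open Classical in
/-- The resolvent operator of `T` at `z` (junk value `0` if `z` is not in the resolvent set). -/
def res (T : X →ₗ.[ℂ] X) (z : ℂ) : X →L[ℂ] X :=
  if h : z ∈ resolventSet T then Classical.choose h else 0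

open Classical in
/-- Application of an unbounded operator, with junk value `0` outside of the domain. -/
def pApply (T : X →ₗ.[ℂ] X) (u : X) : X :=
  if h : u ∈ T.domain then T ⟨u, h⟩ else 0

/-- `R` is a bounded resolvent at `z` of the part of `T` in the range of the
(not necessarily orthogonal) projection `Q`. -/
def IsPartResolventAt (T : X →ₗ.[ℂ] X) (Q : X →L[ℂ] X) (z : ℂ) (R : X →L[ℂ] X) : Prop :=
  (∀ y, R (Q y) = R y) ∧ (∀ y, Q (R y) = R y) ∧
  (∀ y, ∃ hy : R y ∈ T.domain, T ⟨R y, hy⟩ - z • R y = Q y) ∧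
  (∀ u : T.domain, Q (u : X) = (u : X) → R (T u - z • (u : X)) = (u : X))

/-- The spectrum of the part `T|_{ran Q}` of `T` in the range of the projection `Q`. -/
def partSpec (T : X →ₗ.[ℂ] X) (Q : X →L[ℂ] X) : Set ℂ :=
  {z | ¬∃ R, IsPartResolventAt T Q z R}

/-- `T` is decomposed according to `X = Q₊X ∔ Q₋X`: the `Q₊, Q₋` are complementary (bounded)
projections whose ranges are invariant under `T`. -/
def DecomposedBy (T : X →ₗ.[ℂ] X) (Qp Qm : X →L[ℂ] X) : Prop :=
  Qp + Qm = 1 ∧ IsIdempotentElem Qp ∧ IsIdempotentElem Qm ∧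
  (∀ u : T.domain, ∃ hp : Qp (u : X) ∈ T.domain, T ⟨Qp (u : X), hp⟩ = Qp (T u)) ∧
  (∀ u : T.domain, ∃ hm : Qm (u : X) ∈ T.domain, T ⟨Qm (u : X), hm⟩ = Qm (T u))

/-- `D` is a core for the closed operator `T`: the closure of the restriction of `T` to `D`
is again `T`. -/
def IsCore (T : X →ₗ.[ℂ] X) (D : Submodule ℂ X) : Prop :=
  D ≤ T.domain ∧ (T.domRestrict D).closure = T

/-- The operator `W⁻¹ T W` (with `W' = W⁻¹`). -/
def conjPMap (W W' : X →L[ℂ] X) (T : X →ₗ.[ℂ] X) : X →ₗ.[ℂ] X where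
  domain := T.domain.comap (W : X →ₗ[ℂ] X)
  toFun := (W' : X →ₗ[ℂ] X) ∘ₗ (T.toFun ∘ₗ ((W : X →ₗ[ℂ] X).restrict fun _ hx => hx))

/-- The linear span of the graph of `f` restricted to `D`; if `f` is linear on `D` this is
the graph of the corresponding operator with domain `D`. -/
def graphSpan (D : Submodule ℂ X) (f : X → X) : Submodule ℂ (X × X) :=
  Submodule.span ℂ {p : X × X | p.1 ∈ D ∧ p.2 = f p.1}

/-- The unbounded operator with domain `D` acting as `f` (obtained from the span of the
graph of `f|_D`). -/
def pmapOf (D : Submodule ℂ X) (f : X → X) : X →ₗ.[ℂ] X := (graphSpan D f).toLinearPMap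
section Hilbert

variable {H : Type*} [NormedAddCommGroup H] [InnerProductSpace ℂ H] [CompleteSpace H]

local notation "⟪" x ", " y "⟫" => @inner ℂ _ _ x y

/-- The inverse of a bounded operator `J`, as an unbounded operator (defined via the
flipped graph of `J`; if `J` is injective this is the genuine inverse with domain `ran J`). -/
def pinv (J : H →L[ℂ] H) : H →ₗ.[ℂ] H :=
  ((LinearMap.graph (J : H →ₗ[ℂ] H)).map
    ((LinearEquiv.prodComm ℂ H H) : H × H →ₗ[ℂ] H × H)).toLinearPMap

/-- For `R` self-adjoint, `|R| = √(R²)`. -/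
def absCLM (R : H →L[ℂ] H) : H →L[ℂ] H := CFC.sqrt (R * R)

/-- For `R = H₀⁻¹` with `H₀` self-adjoint, this is `|H₀|^{-1/2} = √(|R|)`. -/
def invSqrtAbs (R : H →L[ℂ] H) : H →L[ℂ] H := CFC.sqrt (absCLM R)

/-- For `R = H₀⁻¹` with `H₀` self-adjoint, this is the unbounded operator `|H₀|^{1/2}`,
realized as the inverse of `|H₀|^{-1/2}`; its domain is `dom |H₀|^{1/2}`. -/
def sqrtAbsPMap (R : H →L[ℂ] H) : H →ₗ.[ℂ] H := pinv (invSqrtAbs R)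

/-- `U` is the sign `sign(H₀) = sign(H₀⁻¹) = sign(R)` of the boundedly invertible self-adjoint
operator `H₀ = R⁻¹`: a self-adjoint involution with `R U = U R = |R|`. -/
def IsSignOf (U R : H →L[ℂ] H) : Prop :=
  IsSelfAdjoint U ∧ U * U = 1 ∧ R * U = absCLM R ∧ U * R = absCLM R

/-- The quadratic form `h₀` represented by `H₀ = R⁻¹`:
`h₀[u,w] = (|H₀|^{1/2}u, sign(H₀)|H₀|^{1/2}w)`, linear in `u` and conjugate-linear in `w`
(values outside `dom |H₀|^{1/2}` are junk). -/
def h0form (R U : H →L[ℂ] H) (u w : H) : ℂ :=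
  ⟪U (pApply (sqrtAbsPMap R) w), pApply (sqrtAbsPMap R) u⟫

/-- `v` is a sesquilinear form on `Q` (linear in the first, conjugate-linear in the second
argument, as in the paper). -/
def SesqOn (Q : Submodule ℂ H) (v : H → H → ℂ) : Prop :=
  (∀ u₁ u₂ w, u₁ ∈ Q → u₂ ∈ Q → w ∈ Q → v (u₁ + u₂) w = v u₁ w + v u₂ w) ∧
  (∀ (c : ℂ) u w, u ∈ Q → w ∈ Q → v (c • u) w = c * v u w) ∧
  (∀ u w₁ w₂, u ∈ Q → w₁ ∈ Q → w₂ ∈ Q → v u (w₁ + w₂) = v u w₁ + v u w₂) ∧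
  (∀ (c : ℂ) u w, u ∈ Q → w ∈ Q → v u (c • w) = (starRingEnd ℂ) c * v u w)

/-- `T` is the operator associated with the densely defined sesquilinear form `h`
with form domain `Q` (in the sense of the paper):
`T` is closed and densely defined, `dom T, dom T* ⊆ Q`, `(Tu, w) = h[u, w]` for
`u ∈ dom T`, `w ∈ Q`, and `(u, T*w) = h[u, w]` for `u ∈ Q`, `w ∈ dom T*`.
(The paper's inner product `(·,·)` is linear in the first argument, so
`(x, y) = ⟪y, x⟫` in Mathlib conventions.) -/
def IsAssocForm (Q : Submodule ℂ H) (h : H → H → ℂ) (T : H →ₗ.[ℂ] H) : Prop :=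
  T.IsClosed ∧ Dense (T.domain : Set H) ∧ T.domain ≤ Q ∧ T.adjoint.domain ≤ Q ∧
  (∀ u : T.domain, ∀ w ∈ Q, ⟪w, T u⟫ = h u w) ∧
  (∀ u ∈ Q, ∀ w : T.adjoint.domain, ⟪T.adjoint w, u⟫ = h u w)

/-- `‖H_{a,b}^{1/2} u‖ = (a‖u‖² + b‖|H₀|^{1/2}u‖²)^{1/2}` for `u ∈ dom |H₀|^{1/2}`,
where `H_{a,b} = a + b|H₀|` and `R = H₀⁻¹`. -/
def habNorm (R : H →L[ℂ] H) (a b : ℝ) (u : H) : ℝ :=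
  Real.sqrt (a * ‖u‖ ^ 2 + b * ‖pApply (sqrtAbsPMap R) u‖ ^ 2)

/-- `Pp, Pm` are the spectral projections of the bounded self-adjoint operator `R` onto its
positive and negative spectral subspaces (`R` is assumed injective, e.g. the inverse of a
self-adjoint operator, so that the pair is uniquely determined). -/
def IsPosNegPair (R Pp Pm : H →L[ℂ] H) : Prop :=
  Pp + Pm = 1 ∧ IsSelfAdjoint Pp ∧ IsSelfAdjoint Pm ∧
  IsIdempotentElem Pp ∧ IsIdempotentElem Pm ∧
  Pp * R = R * Pp ∧
  (∀ x : H, 0 ≤ (⟪Pp x, R (Pp x)⟫).re) ∧ (∀ x : H, (⟪Pm x, R (Pm x)⟫).re ≤ 0)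

/-- Membership in the Schatten-von Neumann class of order `p`, via the Schmidt
representation `A = ∑ sₙ ⟪eₙ, ·⟫ fₙ` with `(sₙ) ∈ ℓᵖ`. -/
def MemSchatten (p : ℝ) (A : H →L[ℂ] H) : Prop :=
  ∃ (s : ℕ → ℝ) (e f : ℕ → H), Orthonormal ℂ e ∧ Orthonormal ℂ f ∧ (∀ n, 0 ≤ s n) ∧
    Summable (fun n => s n ^ p) ∧
    ∀ x : H, HasSum (fun n => s n • (⟪e n, x⟫ • f n)) (A x)

end Hilbert


section Dirac

open ComplexConjugate

/-- Euclidean 3-space. -/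
abbrev V3 := EuclideanSpace ℝ (Fin 3)

/-- The spinor space `ℂ⁴`. -/
abbrev C4 := EuclideanSpace ℂ (Fin 4)

/-- Two-component spinors `ℂ²`. -/
abbrev C2 := EuclideanSpace ℂ (Fin 2)

/-- The Hilbert space `L²(ℝ³, ℂ⁴)`. -/
abbrev DSp := MeasureTheory.Lp (α := V3) C4 2 (volume : Measure V3)

/-- The Hilbert space `L²(ℝ³, ℂ²)` (for the Pauli operator). -/
abbrev DSp2 := MeasureTheory.Lp (α := V3) C2 2 (volume : Measure V3)

/-- Application of a `4 × 4` matrix to a spinor. -/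
def mapp (M : Matrix (Fin 4) (Fin 4) ℂ) (ξ : C4) : C4 :=
  (WithLp.equiv 2 (Fin 4 → ℂ)).symm (M.mulVec (WithLp.equiv 2 (Fin 4 → ℂ) ξ))

/-- Application of a `2 × 2` matrix to a two-component spinor. -/
def mapp2 (M : Matrix (Fin 2) (Fin 2) ℂ) (ξ : C2) : C2 :=
  (WithLp.equiv 2 (Fin 2 → ℂ)).symm (M.mulVec (WithLp.equiv 2 (Fin 2 → ℂ) ξ))

/-- The Pauli matrices `σ₁, σ₂, σ₃`. -/
def pauli : Fin 3 → Matrix (Fin 2) (Fin 2) ℂ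
  | 0 => !![0, 1; 1, 0]
  | 1 => !![0, -Complex.I; Complex.I, 0]
  | 2 => !![1, 0; 0, -1]

/-- The Dirac matrices `α_j = [[0, σ_j], [σ_j, 0]]`. -/
def diracα : Fin 3 → Matrix (Fin 4) (Fin 4) ℂ
  | 0 => !![0, 0, 0, 1;
            0, 0, 1, 0;
            0, 1, 0, 0;
            1, 0, 0, 0]
  | 1 => !![0, 0, 0, -Complex.I;
            0, 0, Complex.I, 0;
            0, -Complex.I, 0, 0;
            Complex.I, 0, 0, 0]
  | 2 => !![0, 0, 1, 0;
            0, 0, 0, -1;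
            1, 0, 0, 0;
            0, -1, 0, 0]

/-- The Dirac matrix `β = diag(1, 1, -1, -1)`. -/
def diracβ : Matrix (Fin 4) (Fin 4) ℂ :=
  !![1, 0, 0, 0;
     0, 1, 0, 0;
     0, 0, -1, 0;
     0, 0, 0, -1]

/-- The projection onto the upper two spinor components. -/
def upperMat : Matrix (Fin 4) (Fin 4) ℂ :=
  !![1, 0, 0, 0;
     0, 1, 0, 0;
     0, 0, 0, 0;
     0, 0, 0, 0]

/-- The projection onto the lower two spinor components. -/
def lowerMat : Matrix (Fin 4) (Fin 4) ℂ :=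
  !![0, 0, 0, 0;
     0, 0, 0, 0;
     0, 0, 1, 0;
     0, 0, 0, 1]

/-- The classical action of the free Dirac operator
`H₀ = β - i Σ_j α_j ∂_j` on a differentiable function. -/
def diracAct (f : V3 → C4) (x : V3) : C4 :=
  mapp diracβ (f x) -
    Complex.I • ∑ j : Fin 3, mapp (diracα j) (fderiv ℝ f x (EuclideanSpace.single j (1 : ℝ)))

/-- The classical action of the magnetic Dirac operator
`H_A = β - i Σ_j α_j ∂_j - Σ_j A_j α_j` (i.e. with `-iσ·∇` replaced by
`-iσ·∇_A = -iσ·∇ - σ·A`). -/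
def diracActA (A : V3 → V3) (f : V3 → C4) (x : V3) : C4 :=
  mapp diracβ (f x) -
    Complex.I • ∑ j : Fin 3, mapp (diracα j) (fderiv ℝ f x (EuclideanSpace.single j (1 : ℝ))) -
    ∑ j : Fin 3, (A x j : ℂ) • mapp (diracα j) (f x)

/-- The classical action of the operator `-iσ·∇_A = -iσ·∇ - σ·A` on two-component spinors. -/
def pauliDiracAct (A : V3 → V3) (f : V3 → C2) (x : V3) : C2 :=
  (-Complex.I) • ∑ j : Fin 3, mapp2 (pauli j) (fderiv ℝ f x (EuclideanSpace.single j (1 : ℝ))) -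
    ∑ j : Fin 3, (A x j : ℂ) • mapp2 (pauli j) (f x)

/-- A smooth compactly supported (test) function. -/
def IsTestFn (f : V3 → C4) : Prop := ContDiff ℝ (⊤ : ℕ∞) f ∧ HasCompactSupport f

/-- A smooth compactly supported function supported away from the origin. -/
def IsTestFnAway (f : V3 → C4) : Prop :=
  ContDiff ℝ (⊤ : ℕ∞) f ∧ HasCompactSupport f ∧ (0 : V3) ∉ tsupport f

/-- The subspace of `L²(ℝ³, ℂ⁴)` of (classes of) test functions. -/
def testSub : Submodule ℂ DSp :=
  Submodule.span ℂ {u : DSp | ∃ f : V3 → C4, IsTestFn f ∧ ⇑u =ᵐ[volume] f}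

/-- The subspace of (classes of) test functions supported away from the origin,
`C₀^∞(ℝ³ \ {0})⁴`. -/
def testSubAway : Submodule ℂ DSp :=
  Submodule.span ℂ {u : DSp | ∃ f : V3 → C4, IsTestFnAway f ∧ ⇑u =ᵐ[volume] f}

/-- `H₀` is the free Dirac operator on `ℝ³` (units `m = c = ħ = 1`): it is self-adjoint,
acts as `diracAct` on test functions, and the test functions form a core (which, together
with self-adjointness, determines it uniquely; its domain is `H¹(ℝ³, ℂ⁴)`). -/
def IsFreeDirac (H0 : DSp →ₗ.[ℂ] DSp) : Prop :=
  H0.adjoint = H0 ∧ IsCore H0 testSub ∧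
  ∀ (u : DSp) (f : V3 → C4), IsTestFn f → ⇑u =ᵐ[volume] f →
    ∃ hu : u ∈ H0.domain, ⇑(H0 ⟨u, hu⟩) =ᵐ[volume] fun x => diracAct f x

/-- `HA` is the magnetic Dirac operator with vector potential `A`: the self-adjoint
closure of the classical magnetic Dirac operator on `C₀^∞(ℝ³ \ {0})⁴` (on which it is
essentially self-adjoint). -/
def IsMagneticDirac (A : V3 → V3) (HA : DSp →ₗ.[ℂ] DSp) : Prop :=
  HA.adjoint = HA ∧ IsCore HA testSubAway ∧
  ∀ (u : DSp) (f : V3 → C4), IsTestFnAway f → ⇑u =ᵐ[volume] f →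
    ∃ hu : u ∈ HA.domain, ⇑(HA ⟨u, hu⟩) =ᵐ[volume] fun x => diracActA A f x

/-- `Bfun` is the distributional curl of the vector potential `A`:
`(curl A)_i = ∂_{i+1} A_{i+2} - ∂_{i+2} A_{i+1}` (cyclically), tested against smooth
compactly supported functions. -/
def IsCurlOf (A : V3 → V3) (Bfun : V3 → V3) : Prop :=
  ∀ (i : Fin 3) (φ : V3 → ℝ), ContDiff ℝ (⊤ : ℕ∞) φ → HasCompactSupport φ →
    ∫ x : V3, Bfun x i * φ x =
      ∫ x : V3, (A x (i + 1) * fderiv ℝ φ x (EuclideanSpace.single (i + 2) (1 : ℝ)) -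
        A x (i + 2) * fderiv ℝ φ x (EuclideanSpace.single (i + 1) (1 : ℝ)))

end Dirac

section AbstractProjections

variable {H : Type*} [NormedAddCommGroup H] [InnerProductSpace ℂ H] [CompleteSpace H]

/-- The sign of `R` times `R` is nonnegative. -/
lemma IsPosNegPair.sub_mul_nonneg {R Pp Pm : H →L[ℂ] H} (hR : IsSelfAdjoint R)
    (h : IsPosNegPair R Pp Pm) : 0 ≤ (Pp - Pm) * R := by
  obtain ⟨hsum, hp, hm, hpi, hmi, hcomm, hpos, hneg⟩ := h
  have hm' : Pm = 1 - Pp := by rw [← hsum]; abel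
  have hcommm : Pm * R = R * Pm := by rw [hm', sub_mul, mul_sub, hcomm, one_mul, mul_one]
  have hS : IsSelfAdjoint (Pp - Pm) := hp.sub hm
  rw [ContinuousLinearMap.nonneg_iff_isPositive, ContinuousLinearMap.isPositive_def']
  refine ⟨?_, fun x => ?_⟩
  · rw [IsSelfAdjoint, star_mul, hR.star_eq, hS.star_eq, sub_mul, mul_sub, hcomm, hcommm]
  · have e1 : Pp * R = Pp * (R * Pp) := by
      rw [← hcomm, ← mul_assoc, hpi.eq]
    have e2 : Pm * R = Pm * (R * Pm) := by
      rw [← hcommm, ← mul_assoc, hmi.eq]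
    have e3 : ((Pp - Pm) * R) x = Pp (R (Pp x)) - Pm (R (Pm x)) := by
      rw [sub_mul, e1, e2]; rfl
    have hp' : ∀ y z, inner ℂ (Pp y) z = inner ℂ y (Pp z) := hp.isSymmetric
    have hm'' : ∀ y z, inner ℂ (Pm y) z = inner ℂ y (Pm z) := hm.isSymmetric
    rw [ContinuousLinearMap.reApplyInnerSelf_apply, e3, inner_sub_left, map_sub, hp', hm'',
      inner_re_symm, inner_re_symm (𝕜 := ℂ) (R (Pm x))]
    have h1 := hpos x
    have h2 := hneg x
    simp only [RCLike.re_eq_complex_re] at *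
    linarith

/-- If `2 P - 1` and `R` satisfy `(2 P - 1)R + R(2 P - 1) = 2 R²`, the square of the difference
of `P` and the positive spectral projection of `R` is `(1 - |R|) / 2`. -/
lemma IsPosNegPair.sq_sub_add {R Pp Pm P : H →L[ℂ] H} (hR : IsSelfAdjoint R)
    (hinj : Function.Injective R) (h : IsPosNegPair R Pp Pm) (hP : IsIdempotentElem P)
    (hPR : (P + P - 1) * R + R * (P + P - 1) = R * R + R * R) :
    (P - Pp) * (P - Pp) + (P - Pp) * (P - Pp) + (Pp - Pm) * R = 1 := by
  have hT := h.sub_mul_nonneg hR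
  obtain ⟨hsum, hp, hm, hpi, hmi, hcomm, hpos, hneg⟩ := h
  have hm' : Pm = 1 - Pp := by rw [← hsum]; abel
  set S := Pp - Pm with hS
  set B := P + P - 1 with hB
  set T := S * R with hTdef
  have hS' : S = Pp + Pp - 1 := by rw [hS, hm']; abel
  have hSS : S * S = 1 := by
    rw [hS']; simp only [mul_sub, sub_mul, mul_add, add_mul, hpi.eq, mul_one, one_mul]; abel
  have hSR : S * R = R * S := by
    rw [hS']; simp only [mul_sub, sub_mul, mul_add, add_mul, hcomm, mul_one, one_mul]
  have hTT : T * T = R * R := by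
    calc T * T = S * (R * S) * R := by simp only [hTdef, mul_assoc]
      _ = (S * S) * (R * R) := by rw [← hSR]; simp only [mul_assoc]
      _ = R * R := by rw [hSS, one_mul]
  have hTS : T * S = R := by rw [hTdef, hSR, mul_assoc, hSS, mul_one]
  have hanti : (B - R) * R = -(R * (B - R)) := by
    rw [eq_neg_iff_add_eq_zero, sub_mul, mul_sub]
    calc B * R - R * R + (R * B - R * R) = (B * R + R * B) - (R * R + R * R) := by abel
      _ = 0 := by rw [hPR, sub_self]
  have hcR : Commute (R * R) (B - R) := by
    rw [commute_iff_eq, mul_assoc, ← mul_assoc (B - R), hanti, neg_mul, mul_assoc, hanti,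
      mul_neg, neg_neg]
  have hcT : T * (B - R) = (B - R) * T := by
    have : CFC.sqrt (R * R) = T := CFC.sqrt_unique hTT hT
    rw [← this, CFC.sqrt]
    exact (hcR.cfcₙ_nnreal _).eq
  have hTX : T * ((B - R) * S + S * (B - R)) = 0 := by
    rw [mul_add, ← mul_assoc, hcT, mul_assoc, hTS, ← mul_assoc, hTS, hanti, neg_add_cancel]
  have hX : (B - R) * S + S * (B - R) = 0 := by
    ext x
    have h1 : R * R * ((B - R) * S + S * (B - R)) = 0 := by
      rw [← hTT, mul_assoc, hTX, mul_zero]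
    have h2 : R (R (((B - R) * S + S * (B - R)) x)) = 0 := congrArg (fun A => A x) h1
    have h3 := hinj (h2.trans (map_zero R).symm)
    exact hinj (h3.trans (map_zero R).symm)
  have hBS : B * S + S * B = T + T := by
    have : B * S + S * B = ((B - R) * S + S * (B - R)) + (R * S + S * R) := by
      rw [sub_mul B R S, mul_sub S B R]; abel
    rw [this, hX, zero_add, ← hSR]
  have h2 : (2 : ℂ) • ((P - Pp) * (P - Pp) + (P - Pp) * (P - Pp) + T) = (2 : ℂ) • 1 := by
    rw [two_smul, two_smul]
    have h3 : B * S + S * B = P * Pp + P * Pp + P * Pp + P * Pp + Pp * P + Pp * P + Pp * P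
        + Pp * P - P - P - P - P - Pp - Pp - Pp - Pp + 1 + 1 := by
      rw [hB, hS']; simp only [mul_sub, sub_mul, mul_add, add_mul, mul_one, one_mul]; abel
    have h4 : ((P - Pp) * (P - Pp) + (P - Pp) * (P - Pp) + T) +
        ((P - Pp) * (P - Pp) + (P - Pp) * (P - Pp) + T) =
        ((P - Pp) * (P - Pp) + (P - Pp) * (P - Pp)) +
        ((P - Pp) * (P - Pp) + (P - Pp) * (P - Pp)) + (T + T) := by abel
    rw [h4, ← hBS, h3]
    simp only [mul_sub, sub_mul, hP.eq, hpi.eq]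
    abel
  exact smul_right_injective _ (two_ne_zero : (2 : ℂ) ≠ 0) h2

/-- If moreover `R` is not bounded below, the distance between `P` and the positive spectral
projection of `R` is `1 / √2`. -/
lemma IsPosNegPair.norm_sub_eq {R Pp Pm P : H →L[ℂ] H} (hR : IsSelfAdjoint R)
    (hinj : Function.Injective R) (h : IsPosNegPair R Pp Pm) (hP : IsIdempotentElem P)
    (hPsa : IsSelfAdjoint P)
    (hPR : (P + P - 1) * R + R * (P + P - 1) = R * R + R * R)
    (hunb : ∀ n : ℕ, ∃ x : H, x ≠ 0 ∧ n * ‖R x‖ ≤ ‖x‖) :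
    ‖P - Pp‖ = (Real.sqrt 2)⁻¹ := by
  have hT := h.sub_mul_nonneg hR
  have hsq := h.sq_sub_add hR hinj hP hPR
  obtain ⟨hsum, hp, hm, hpi, hmi, hcomm, hpos, hneg⟩ := h
  have hDsa : IsSelfAdjoint (P - Pp) := hPsa.sub hp
  set D := P - Pp with hD
  have key : ∀ x, 2 * ‖D x‖ ^ 2 + (inner ℂ x (((Pp - Pm) * R) x)).re = ‖x‖ ^ 2 := by
    intro x
    have hDs : ∀ y z, inner ℂ (D y) z = inner ℂ y (D z) := hDsa.isSymmetric
    have h1 : D (D x) + D (D x) + ((Pp - Pm) * R) x = x := congrArg (fun A => A x) hsq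
    have h2 : (inner ℂ x (D (D x) + D (D x) + ((Pp - Pm) * R) x)).re = ‖x‖ ^ 2 := by
      rw [h1]; exact inner_self_eq_norm_sq (𝕜 := ℂ) x
    have h3 : (inner ℂ x (D (D x))).re = ‖D x‖ ^ 2 := by
      rw [← hDs]; exact inner_self_eq_norm_sq (𝕜 := ℂ) (D x)
    rw [inner_add_right, inner_add_right, Complex.add_re, Complex.add_re, h3] at h2
    linarith
  have hs2 : ((Real.sqrt 2)⁻¹) ^ 2 = 1 / 2 := by
    rw [inv_pow, Real.sq_sqrt (by norm_num)]; norm_num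
  have hs0 : 0 ≤ (Real.sqrt 2)⁻¹ := by positivity
  apply le_antisymm
  · refine ContinuousLinearMap.opNorm_le_bound _ hs0 fun x => ?_
    have h1 : 0 ≤ (inner ℂ x (((Pp - Pm) * R) x)).re :=
      ((ContinuousLinearMap.nonneg_iff_isPositive _).mp hT).re_inner_nonneg_right x
    refine le_of_sq_le_sq ?_ (by positivity)
    rw [mul_pow, hs2]
    linarith [key x]
  · have hSnorm : ∀ y, ‖(Pp - Pm) y‖ ≤ ‖Pp - Pm‖ * ‖y‖ := fun y => (Pp - Pm).le_opNorm y
    have hbd : ∀ n : ℕ, n * (1 / 2 - ‖D‖ ^ 2) ≤ ‖Pp - Pm‖ / 2 := by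
      intro n
      obtain ⟨x, hx, hn⟩ := hunb n
      have hx' : 0 < ‖x‖ := norm_pos_iff.mpr hx
      have h1 : (inner ℂ x (((Pp - Pm) * R) x)).re ≤ ‖x‖ * (‖Pp - Pm‖ * ‖R x‖) :=
        (Complex.re_le_norm _).trans ((norm_inner_le_norm _ _).trans
          (mul_le_mul_of_nonneg_left (hSnorm (R x)) hx'.le))
      have h2 : ‖D x‖ ^ 2 ≤ ‖D‖ ^ 2 * ‖x‖ ^ 2 := by
        rw [← mul_pow]
        exact pow_le_pow_left₀ (norm_nonneg _) (D.le_opNorm x) 2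
      have h3 : (1 / 2 - ‖D‖ ^ 2) * ‖x‖ ^ 2 ≤ ‖x‖ * (‖Pp - Pm‖ * ‖R x‖) / 2 := by
        linarith [key x]
      have h4 : n * (1 / 2 - ‖D‖ ^ 2) * ‖x‖ ^ 2 ≤ ‖Pp - Pm‖ / 2 * ‖x‖ ^ 2 := by
        calc n * (1 / 2 - ‖D‖ ^ 2) * ‖x‖ ^ 2
            ≤ n * (‖x‖ * (‖Pp - Pm‖ * ‖R x‖) / 2) := by
              rw [mul_assoc]; exact mul_le_mul_of_nonneg_left h3 (Nat.cast_nonneg n)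
          _ = ‖x‖ * ‖Pp - Pm‖ / 2 * (n * ‖R x‖) := by ring
          _ ≤ ‖x‖ * ‖Pp - Pm‖ / 2 * ‖x‖ := mul_le_mul_of_nonneg_left hn (by positivity)
          _ = _ := by ring
      exact le_of_mul_le_mul_right h4 (by positivity)
    refine le_of_sq_le_sq ?_ (norm_nonneg _)
    rw [hs2]
    by_contra! hlt
    obtain ⟨n, hn⟩ := exists_nat_gt (‖Pp - Pm‖ / 2 / (1 / 2 - ‖D‖ ^ 2))
    rw [div_lt_iff₀ (by linarith)] at hn
    linarith [hbd n]

/-- A self-adjoint operator is symmetric (in particular it is densely defined). -/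
lemma inner_apply_eq_of_adjoint_eq {T : H →ₗ.[ℂ] H} (hT : T.adjoint = T) (u v : T.domain) :
    inner ℂ (T u) (v : H) = inner ℂ (u : H) (T v) := by
  by_cases hd : Dense (T.domain : Set H)
  · have h := LinearPMap.adjoint_isFormalAdjoint (T := T) hd
    rw [hT] at h
    exact h u v
  · exfalso
    have h0 : ∀ y : T.adjoint.domain, T.adjoint y = 0 := LinearPMap.adjoint_apply_of_not_dense hd
    have h0' : ∀ y : T.domain, T y = 0 := by rw [hT] at h0; exact h0
    have htop : T.domain = ⊤ := by
      rw [eq_top_iff, ← hT]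
      exact fun y _ => LinearPMap.mem_adjoint_domain_of_exists y ⟨0, fun x => by simp [h0' x]⟩
    rw [htop] at hd
    exact hd dense_univ

lemma IsResolventAt.isSelfAdjoint {T : H →ₗ.[ℂ] H} (hT : T.adjoint = T) {R : H →L[ℂ] H}
    (hR : IsResolventAt T 0 R) : IsSelfAdjoint R := by
  rw [ContinuousLinearMap.isSelfAdjoint_iff_isSymmetric]
  intro x y
  obtain ⟨hx, ex⟩ := hR.2 x
  obtain ⟨hy, ey⟩ := hR.2 y
  rw [zero_smul, sub_zero] at ex ey
  have h := inner_apply_eq_of_adjoint_eq hT ⟨R x, hx⟩ ⟨R y, hy⟩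
  rw [ex, ey] at h
  exact h.symm

omit [CompleteSpace H] in
lemma IsResolventAt.injective {T : H →ₗ.[ℂ] H} {R : H →L[ℂ] H}
    (hR : IsResolventAt T 0 R) : Function.Injective R := by
  intro x y hxy
  obtain ⟨hx, ex⟩ := hR.2 x
  obtain ⟨hy, ey⟩ := hR.2 y
  rw [zero_smul, sub_zero] at ex ey
  rw [← ex, ← ey]
  congr 2

omit [CompleteSpace H] in
/-- A closed linear relation holding on the restriction of `T` to a core holds for `T`. -/
lemma IsCore.graph_le {T : H →ₗ.[ℂ] H} {D : Submodule ℂ H} (hD : IsCore T D)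
    {G : Submodule ℂ (H × H)} (hG : IsClosed (G : Set (H × H)))
    (h : ∀ u : T.domain, (u : H) ∈ D → ((u : H), T u) ∈ G) (u : T.domain) :
    ((u : H), T u) ∈ G := by
  have hr : (T.domRestrict D).graph ≤ G := by
    intro p hp
    rw [LinearPMap.mem_graph_iff] at hp
    obtain ⟨y, hy1, hy2⟩ := hp
    have hyD : (y : H) ∈ D ⊓ T.domain := y.2
    have e : T.domRestrict D y = T ⟨y, hyD.2⟩ := LinearPMap.domRestrict_apply rfl
    have := h ⟨y, hyD.2⟩ hyD.1
    rw [← e, hy2] at this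
    simpa [hy1] using this
  have hu : ((u : H), T u) ∈ T.graph := LinearPMap.mem_graph T u
  have hT : T.graph ≤ G := by
    rw [← hD.2]
    by_cases hc : (T.domRestrict D).IsClosable
    · rw [← hc.graph_closure_eq_closure_graph]
      exact Submodule.topologicalClosure_minimal _ hr hG
    · rw [LinearPMap.closure_def' hc]
      exact hr
  exact hT hu

omit [CompleteSpace H] in
/-- If `BT + TB = 2` on a spanning set of a core of `T`, then the inverse `R` of `T` satisfies
`BR + RB = 2 R²`. -/
lemma IsResolventAt.anticommutator_eq {T : H →ₗ.[ℂ] H} {R B : H →L[ℂ] H} {s : Set H}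
    (hR : IsResolventAt T 0 R) (hcore : IsCore T (Submodule.span ℂ s))
    (h : ∀ u ∈ s, ∃ hu : u ∈ T.domain, R (B (T ⟨u, hu⟩)) + B u = R u + R u) :
    B * R + R * B = R * R + R * R := by
  let G : Submodule ℂ (H × H) :=
    { carrier := {p | R (B p.2) + B p.1 = R p.1 + R p.1}
      zero_mem' := by simp
      add_mem' := fun {p q} hp hq => by
        simp only [Set.mem_ofPred_eq, Prod.fst_add, Prod.snd_add, map_add] at hp hq ⊢
        rw [add_add_add_comm, hp, hq, add_add_add_comm]
      smul_mem' := fun c p hp => by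
        simp only [Set.mem_ofPred_eq, Prod.smul_fst, Prod.smul_snd, map_smul] at hp ⊢
        rw [← smul_add, hp, smul_add] }
  have hG : IsClosed (G : Set (H × H)) := by
    change IsClosed {p : H × H | R (B p.2) + B p.1 = R p.1 + R p.1}
    exact isClosed_eq (by fun_prop) (by fun_prop)
  have htest : ∀ u ∈ Submodule.span ℂ s, ∃ hu : u ∈ T.domain, (u, T ⟨u, hu⟩) ∈ G := by
    intro u hu
    refine Submodule.span_induction ?_ ?_ ?_ ?_ hu
    · exact fun u hu => h u hu
    · refine ⟨T.domain.zero_mem, ?_⟩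
      have : T ⟨0, T.domain.zero_mem⟩ = 0 := T.map_zero
      rw [this]
      exact G.zero_mem
    · rintro x y - - ⟨hx, ex⟩ ⟨hy, ey⟩
      refine ⟨T.domain.add_mem hx hy, ?_⟩
      have : T ⟨x + y, T.domain.add_mem hx hy⟩ = T ⟨x, hx⟩ + T ⟨y, hy⟩ :=
        T.map_add ⟨x, hx⟩ ⟨y, hy⟩
      rw [this]
      exact G.add_mem ex ey
    · rintro c x - ⟨hx, ex⟩
      refine ⟨T.domain.smul_mem c hx, ?_⟩
      have : T ⟨c • x, T.domain.smul_mem c hx⟩ = c • T ⟨x, hx⟩ := T.map_smul c ⟨x, hx⟩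
      rw [this]
      exact G.smul_mem c ex
  refine ContinuousLinearMap.ext fun y => ?_
  obtain ⟨hy, ey⟩ := hR.2 y
  rw [zero_smul, sub_zero] at ey
  have h' : R (B (T ⟨R y, hy⟩)) + B (R y) = R (R y) + R (R y) :=
    hcore.graph_le hG (fun u hu => (htest u hu).2) ⟨R y, hy⟩
  rw [ey, add_comm] at h'
  exact h'

end AbstractProjections

section FreeDirac

lemma mapp_apply (M : Matrix (Fin 4) (Fin 4) ℂ) (ξ : C4) (i : Fin 4) :
    mapp M ξ i = ∑ j, M i j * ξ j := rfl

/-- Application of a matrix to a spinor as a continuous linear map. -/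
def mappCLM (M : Matrix (Fin 4) (Fin 4) ℂ) : C4 →L[ℂ] C4 :=
  LinearMap.toContinuousLinearMap
    { toFun := mapp M
      map_add' := fun x y => by
        ext i; simp [mapp_apply, mul_add, Finset.sum_add_distrib]
      map_smul' := fun c x => by
        ext i; simp only [mapp_apply, PiLp.smul_apply, smul_eq_mul, Finset.mul_sum,
          RingHom.id_apply]
        exact Finset.sum_congr rfl fun j _ => by ring }

lemma mappCLM_apply (M : Matrix (Fin 4) (Fin 4) ℂ) (ξ : C4) : mappCLM M ξ = mapp M ξ := rfl

lemma mapp_upperMat_mapp_upperMat (ξ : C4) :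
    mapp upperMat (mapp upperMat ξ) = mapp upperMat ξ := by
  ext i; fin_cases i <;> simp [mapp_apply, upperMat, Fin.sum_univ_four]

lemma mapp_upperMat_add_mapp_lowerMat (ξ : C4) : mapp upperMat ξ + mapp lowerMat ξ = ξ := by
  ext i; fin_cases i <;> simp [mapp_apply, upperMat, lowerMat, Fin.sum_univ_four]

lemma mapp_upperMat_add_self_sub (ξ : C4) :
    mapp upperMat ξ + mapp upperMat ξ - ξ = mapp diracβ ξ := by
  ext i; fin_cases i <;> simp [mapp_apply, upperMat, diracβ, Fin.sum_univ_four]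

lemma inner_mapp_upperMat (ξ η : C4) :
    inner ℂ (mapp upperMat ξ) η = inner ℂ ξ (mapp upperMat η) := by
  simp [PiLp.inner_apply, mapp_apply, upperMat, Fin.sum_univ_four]

lemma mapp_diracβ_mapp_diracβ (ξ : C4) : mapp diracβ (mapp diracβ ξ) = ξ := by
  ext i; fin_cases i <;> simp [mapp_apply, diracβ, Fin.sum_univ_four]

lemma mapp_diracα_mapp_diracβ (j : Fin 3) (ξ : C4) :
    mapp (diracα j) (mapp diracβ ξ) = -mapp diracβ (mapp (diracα j) ξ) := by
  ext i; fin_cases j <;> fin_cases i <;>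
    simp [mapp_apply, diracβ, diracα, Fin.sum_univ_four]

lemma fderiv_mapp {f : V3 → C4} {x : V3} (hf : DifferentiableAt ℝ f x)
    (M : Matrix (Fin 4) (Fin 4) ℂ) (v : V3) :
    fderiv ℝ (fun y => mapp M (f y)) x v = mapp M (fderiv ℝ f x v) := by
  have h := ((mappCLM M).restrictScalars ℝ).hasFDerivAt.comp x hf.hasFDerivAt
  have h' : HasFDerivAt (fun y => mapp M (f y))
    (((mappCLM M).restrictScalars ℝ).comp (fderiv ℝ f x)) x := h
  rw [h'.fderiv]
  rfl

/-- The anticommutator of `β` and the Dirac operator is `2`. -/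
lemma mapp_diracβ_diracAct_add {f : V3 → C4} {x : V3} (hf : DifferentiableAt ℝ f x) :
    mapp diracβ (diracAct f x) + diracAct (fun y => mapp diracβ (f y)) x = f x + f x := by
  simp only [diracAct, fderiv_mapp hf, mapp_diracα_mapp_diracβ, mapp_diracβ_mapp_diracβ]
  simp only [← mappCLM_apply, map_sub, map_smul, map_sum]
  simp only [mappCLM_apply, mapp_diracβ_mapp_diracβ, Finset.sum_neg_distrib, smul_neg]
  abel

lemma IsTestFn.mapp {f : V3 → C4} (hf : IsTestFn f) (M : Matrix (Fin 4) (Fin 4) ℂ) :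
    IsTestFn fun x => mapp M (f x) :=
  ⟨((mappCLM M).restrictScalars ℝ).contDiff.comp hf.1,
    hf.2.comp_left (g := Paper.mapp M) (map_zero (mappCLM M))⟩

variable {H0 : DSp →ₗ.[ℂ] DSp} {R Pu Pl : DSp →L[ℂ] DSp}

lemma isIdempotentElem_of_ae_eq_mapp_upperMat
    (hPu : ∀ u : DSp, ⇑(Pu u) =ᵐ[volume] fun x => mapp upperMat ((u : V3 → C4) x)) :
    IsIdempotentElem Pu := by
  refine ContinuousLinearMap.ext fun u => Lp.ext ?_
  filter_upwards [hPu u, hPu (Pu u)] with x h1 h2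
  rw [mul_apply_eq_comp, h2, h1, mapp_upperMat_mapp_upperMat]

lemma isSelfAdjoint_of_ae_eq_mapp_upperMat
    (hPu : ∀ u : DSp, ⇑(Pu u) =ᵐ[volume] fun x => mapp upperMat ((u : V3 → C4) x)) :
    IsSelfAdjoint Pu := by
  rw [ContinuousLinearMap.isSelfAdjoint_iff_isSymmetric]
  intro u v
  change inner ℂ (Pu u) v = inner ℂ u (Pu v)
  rw [L2.inner_def, L2.inner_def]
  refine integral_congr_ae ?_
  filter_upwards [hPu u, hPu v] with x h1 h2
  rw [h1, h2, inner_mapp_upperMat]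

lemma add_eq_one_of_ae_eq_mapp
    (hPu : ∀ u : DSp, ⇑(Pu u) =ᵐ[volume] fun x => mapp upperMat ((u : V3 → C4) x))
    (hPl : ∀ u : DSp, ⇑(Pl u) =ᵐ[volume] fun x => mapp lowerMat ((u : V3 → C4) x)) :
    Pu + Pl = 1 := by
  refine ContinuousLinearMap.ext fun u => Lp.ext ?_
  filter_upwards [hPu u, hPl u, Lp.coeFn_add (Pu u) (Pl u)] with x h1 h2 h3
  change (Pu u + Pl u : DSp) x = u x
  rw [h3, Pi.add_apply, h1, h2, mapp_upperMat_add_mapp_lowerMat]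

lemma ae_eq_mapp_diracβ
    (hPu : ∀ u : DSp, ⇑(Pu u) =ᵐ[volume] fun x => mapp upperMat ((u : V3 → C4) x)) (u : DSp) :
    ⇑((Pu + Pu - 1) u) =ᵐ[volume] fun x => mapp diracβ ((u : V3 → C4) x) := by
  have e : (Pu + Pu - 1) u = Pu u + Pu u - u := rfl
  rw [e]
  filter_upwards [hPu u, Lp.coeFn_add (Pu u) (Pu u), Lp.coeFn_sub (Pu u + Pu u) u]
    with x h1 h2 h3
  rw [h3, Pi.sub_apply, h2, Pi.add_apply, h1, mapp_upperMat_add_self_sub]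

/-- On test functions, `H₀⁻¹βH₀ + β = 2 H₀⁻¹`. -/
lemma IsFreeDirac.resolvent_anticommutator_of_isTestFn (hH0 : IsFreeDirac H0)
    (hR : IsResolventAt H0 0 R) {B : DSp →L[ℂ] DSp}
    (hβ : ∀ u : DSp, ⇑(B u) =ᵐ[volume] fun x => mapp diracβ ((u : V3 → C4) x))
    {u : DSp} {f : V3 → C4} (hf : IsTestFn f) (huf : ⇑u =ᵐ[volume] f) (hu : u ∈ H0.domain) :
    R (B (H0 ⟨u, hu⟩)) + B u = R u + R u := by
  obtain ⟨hu', hHu⟩ := hH0.2.2 u f hf huf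
  have hBf : ⇑(B u) =ᵐ[volume] fun x => mapp diracβ (f x) := by
    filter_upwards [hβ u, huf] with x h1 h2
    rw [h1, h2]
  obtain ⟨hBu, hHBu⟩ := hH0.2.2 (B u) _ (hf.mapp diracβ) hBf
  have hRH : R (H0 ⟨B u, hBu⟩) = B u := by
    have := hR.1 ⟨B u, hBu⟩
    rwa [zero_smul, sub_zero] at this
  have hsum : B (H0 ⟨u, hu⟩) + H0 ⟨B u, hBu⟩ = u + u := by
    refine Lp.ext ?_
    filter_upwards [hβ (H0 ⟨u, hu⟩), huf, hHu, hHBu, Lp.coeFn_add u u,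
      Lp.coeFn_add (B (H0 ⟨u, hu⟩)) (H0 ⟨B u, hBu⟩)] with x h1 h2 h3 h4 h5 h6
    rw [h6, h5, Pi.add_apply, Pi.add_apply, h1, h2, h3, h4]
    exact mapp_diracβ_diracAct_add ((hf.1.differentiable (by simp)).differentiableAt)
  rw [← hRH, ← map_add, hsum, map_add]

/-- The inverse of the free Dirac operator satisfies `βH₀⁻¹ + H₀⁻¹β = 2 H₀⁻²`. -/
lemma IsFreeDirac.anticommutator_resolvent (hH0 : IsFreeDirac H0) (hR : IsResolventAt H0 0 R)
    {B : DSp →L[ℂ] DSp}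
    (hβ : ∀ u : DSp, ⇑(B u) =ᵐ[volume] fun x => mapp diracβ ((u : V3 → C4) x)) :
    B * R + R * B = R * R + R * R := by
  refine hR.anticommutator_eq hH0.2.1 ?_
  rintro u ⟨f, hf, huf⟩
  obtain ⟨hu, -⟩ := hH0.2.2 u f hf huf
  exact ⟨hu, hH0.resolvent_anticommutator_of_isTestFn hR hβ hf huf hu⟩

/-- The free Dirac operator is not bounded on test functions. -/
lemma exists_isTestFn_diracAct_ge (n : ℕ) :
    ∃ f : V3 → C4, IsTestFn f ∧ f 0 ≠ 0 ∧ ∀ x, n * ‖f x‖ ≤ ‖diracAct f x‖ := by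
  let φ : ContDiffBump (0 : V3) := ⟨1, 2, one_pos, one_lt_two⟩
  let p : V3 →L[ℝ] ℝ := EuclideanSpace.proj (2 : Fin 3)
  let ψ : V3 → ℂ := fun x => (φ x : ℂ) * Complex.exp (Complex.I * ((n : ℂ) * (p x : ℂ)))
  let e : C4 := EuclideanSpace.single 0 1
  have hφ : ContDiff ℝ (⊤ : ℕ∞) φ := φ.contDiff
  have hψ : ContDiff ℝ (⊤ : ℕ∞) ψ := by
    refine ContDiff.mul (Complex.ofRealCLM.contDiff.comp hφ) ?_
    refine Complex.contDiff_exp.comp (contDiff_const.mul (contDiff_const.mul ?_))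
    exact Complex.ofRealCLM.contDiff.comp p.contDiff
  have hψnorm : ∀ x, ‖ψ x‖ = ‖φ x‖ := fun x => by
    have : Complex.I * ((n : ℂ) * (p x : ℂ)) = ((n * p x : ℝ) : ℂ) * Complex.I := by
      push_cast; ring
    simp only [ψ, this, norm_mul, Complex.norm_exp_ofReal_mul_I, mul_one, Complex.norm_real]
  refine ⟨fun x => ψ x • e, ⟨hψ.smul contDiff_const, ?_⟩, ?_, fun x => ?_⟩
  · have h1 : HasCompactSupport ψ := by
      refine φ.hasCompactSupport.mono fun x hx => ?_
      rw [Function.mem_support, ← norm_ne_zero_iff, hψnorm, norm_ne_zero_iff] at hx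
      exact hx
    exact h1.smul_right
  · rw [← norm_ne_zero_iff, norm_smul, hψnorm, φ.one_of_mem_closedBall]
    · simp [e]
    · simp [φ]
  · have hdφ : HasFDerivAt φ (fderiv ℝ φ x) x :=
      ((hφ.differentiable (by simp)) x).hasFDerivAt
    have hdψ : fderiv ℝ ψ x (EuclideanSpace.single 2 1) =
        Complex.exp (Complex.I * ((n : ℂ) * (p x : ℂ))) *
          ((fderiv ℝ φ x (EuclideanSpace.single 2 1) : ℝ) + Complex.I * (n * φ x : ℝ)) := by
      have h1 : HasFDerivAt (fun y => (φ y : ℂ)) (Complex.ofRealCLM.comp (fderiv ℝ φ x)) x :=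
        Complex.ofRealCLM.hasFDerivAt.comp x hdφ
      have h2 : HasFDerivAt (fun y => (p y : ℂ)) (Complex.ofRealCLM.comp p) x :=
        Complex.ofRealCLM.hasFDerivAt.comp x p.hasFDerivAt
      have h3 := h1.mul (((h2.const_mul (n : ℂ)).const_mul Complex.I).cexp)
      have h4 : HasFDerivAt ψ _ x := h3
      rw [h4.fderiv]
      have hp : p (EuclideanSpace.single 2 1) = 1 := by simp [p]
      simp [hp]
      ring
    have hf : ∀ v, fderiv ℝ (fun y => ψ y • e) x v = fderiv ℝ ψ x v • e := fun v => by
      have := ((hψ.differentiable (by simp)) x).hasFDerivAt.smul_const e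
      rw [this.fderiv]
      rfl
    have hcomp : diracAct (fun y => ψ y • e) x 2 =
        -(Complex.I * fderiv ℝ ψ x (EuclideanSpace.single 2 1)) := by
      simp [diracAct, hf, mapp_apply, Fin.sum_univ_three, diracα, diracβ, e]
    have hexp : ‖Complex.exp (Complex.I * ((n : ℂ) * (p x : ℂ)))‖ = 1 := by
      have : Complex.I * ((n : ℂ) * (p x : ℂ)) = ((n * p x : ℝ) : ℂ) * Complex.I := by
        push_cast; ring
      rw [this, Complex.norm_exp_ofReal_mul_I]
    calc n * ‖ψ x • e‖ = |n * φ x| := by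
          rw [norm_smul, hψnorm, abs_mul, Nat.abs_cast, Real.norm_eq_abs]; simp [e]
      _ = |((fderiv ℝ φ x (EuclideanSpace.single 2 1) : ℝ) +
            Complex.I * (n * φ x : ℝ) : ℂ).im| := by simp
      _ ≤ ‖((fderiv ℝ φ x (EuclideanSpace.single 2 1) : ℝ) +
            Complex.I * (n * φ x : ℝ) : ℂ)‖ := Complex.abs_im_le_norm _
      _ = ‖diracAct (fun y => ψ y • e) x 2‖ := by
          rw [hcomp, hdψ, norm_neg, norm_mul, norm_mul, hexp, Complex.norm_I, one_mul, one_mul]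
      _ ≤ ‖diracAct (fun y => ψ y • e) x‖ := PiLp.norm_apply_le _ _

lemma IsFreeDirac.exists_norm_resolvent_le (hH0 : IsFreeDirac H0) (hR : IsResolventAt H0 0 R)
    (n : ℕ) : ∃ x : DSp, x ≠ 0 ∧ n * ‖R x‖ ≤ ‖x‖ := by
  obtain ⟨f, hf, hf0, hfn⟩ := exists_isTestFn_diracAct_ge n
  have hmem : MemLp f 2 (volume : Measure V3) :=
    hf.1.continuous.memLp_of_hasCompactSupport hf.2
  set u : DSp := hmem.toLp f
  have huf : ⇑u =ᵐ[volume] f := hmem.coeFn_toLp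
  have hu0 : u ≠ 0 := by
    intro h
    rw [h] at huf
    have : f =ᵐ[volume] fun _ => 0 := huf.symm.trans (Lp.coeFn_zero C4 2 volume)
    exact hf0 (congrFun (hf.1.continuous.ae_eq_iff_eq volume continuous_const |>.mp this) 0)
  obtain ⟨hu, hHu⟩ := hH0.2.2 u f hf huf
  have hRu : R (H0 ⟨u, hu⟩) = u := by simpa using hR.1 ⟨u, hu⟩
  refine ⟨H0 ⟨u, hu⟩, fun h => hu0 (by rw [← hRu, h, map_zero]), ?_⟩
  rw [hRu]
  have hle : ‖(n : ℂ) • u‖ ≤ ‖H0 ⟨u, hu⟩‖ := by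
    refine Lp.norm_le_norm_of_ae_le ?_
    filter_upwards [huf, hHu, Lp.coeFn_smul (n : ℂ) u] with x h1 h2 h3
    rw [h3, Pi.smul_apply, h1, h2, norm_smul, Complex.norm_natCast]
    exact hfn x
  rwa [norm_smul, Complex.norm_natCast] at hle

end FreeDirac

/-!
STATEMENT 17: Let `H₀` be the free Dirac operator on `ℝ³`, `P₊, P₋` its spectral
projections onto the positive/negative spectral subspaces, and `P_u, P_l` the orthogonal
projections onto the subspaces of upper- and lower-component spinors (multiplication by
`diag(1,1,0,0)` and `diag(0,0,1,1)`).  Then `‖P_u - P₊‖ = ‖P_l - P₋‖ = 1/√2`.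
-/

theorem statement_17
    (H0 : DSp →ₗ.[ℂ] DSp) (hH0 : IsFreeDirac H0)
    (R : DSp →L[ℂ] DSp) (hR : IsResolventAt H0 0 R)
    (Pp Pm : DSp →L[ℂ] DSp) (hP : IsPosNegPair R Pp Pm)
    (Pu Pl : DSp →L[ℂ] DSp)
    (hPu : ∀ u : DSp, ⇑(Pu u) =ᵐ[volume] fun x => mapp upperMat ((u : V3 → C4) x))
    (hPl : ∀ u : DSp, ⇑(Pl u) =ᵐ[volume] fun x => mapp lowerMat ((u : V3 → C4) x)) :
    ‖Pu - Pp‖ = (Real.sqrt 2)⁻¹ ∧ ‖Pl - Pm‖ = (Real.sqrt 2)⁻¹ := by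
  have h1 : ‖Pu - Pp‖ = (Real.sqrt 2)⁻¹ :=
    hP.norm_sub_eq (hR.isSelfAdjoint hH0.1) hR.injective
      (isIdempotentElem_of_ae_eq_mapp_upperMat hPu) (isSelfAdjoint_of_ae_eq_mapp_upperMat hPu)
      (hH0.anticommutator_resolvent hR (ae_eq_mapp_diracβ hPu)) (hH0.exists_norm_resolvent_le hR)
  have h2 : Pl - Pm = -(Pu - Pp) := by
    rw [← sub_eq_zero]
    calc Pl - Pm - -(Pu - Pp) = (Pu + Pl) - (Pp + Pm) := by abel
      _ = 0 := by rw [add_eq_one_of_ae_eq_mapp hPu hPl, hP.1, sub_self]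
  exact ⟨h1, by rw [h2, norm_neg, h1]⟩

end Paper
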